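/- arXiv:2307.13252 — 11 statements merged into one kernel-verified Lean document; each statement's English description precedes it below -/
import Mathlib

section
/- Let n ≥ 1 and let a = (a₁,…,aₙ) be positive real numbers that are linearly independent over ℚ. Then for every k ∈ ℕ there is exactly one tuple v ∈ (ℤ≥0)ⁿ with v₁ + ⋯ + vₙ = k such that max_{1≤i≤n} aᵢvᵢ ≤ max_{1≤i≤n} aᵢwᵢ for every tuple w ∈ (ℤ≥0)ⁿ with w₁ + ⋯ + wₙ = k. -/
/-- Positive natural multiples of linearly independent reals never coincide. -/
theorem LinearIndependent.eq_of_mul_natCast_eq {ι : Type*} {a : ι → ℝ}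
    (hind : LinearIndependent ℚ a) {i j : ι} {p q : ℕ} (hp : 0 < p)
    (h : a i * (p : ℝ) = a j * (q : ℝ)) : i = j ∧ p = q := by
  have key : Finsupp.single i (p : ℚ) = Finsupp.single j (q : ℚ) := by
    apply hind
    simpa [Finsupp.linearCombination_single, Rat.smul_def, mul_comm] using h
  rcases Finsupp.single_eq_single_iff _ _ _ _ |>.1 key with ⟨hij, hpq⟩ | ⟨h0, -⟩
  · exact ⟨hij, by exact_mod_cast hpq⟩
  · exact absurd h0 (by exact_mod_cast hp.ne')

/-- If two distinct tuples with the same sum share a positive value at a coordinate where both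
weighted maxima are strictly attained, then moving a unit lowers the maximum of the first. -/
theorem exists_sum_eq_iSup_mul_lt {ι : Type*} [Fintype ι] [Nonempty ι] {a : ι → ℝ}
    (hpos : ∀ i, 0 < a i) {v w : ι → ℕ} (hsum : ∑ i, v i = ∑ i, w i) (hne : v ≠ w)
    {i : ι} (hvi : 0 < v i) (hi : v i = w i)
    (hv : ∀ j, j ≠ i → a j * (v j : ℝ) < a i * (v i : ℝ))
    (hw : ∀ j, j ≠ i → a j * (w j : ℝ) < a i * (v i : ℝ)) :
    ∃ u : ι → ℕ, ∑ j, u j = ∑ j, v j ∧ ⨆ j, a j * (u j : ℝ) < a i * (v i : ℝ) := by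
  classical
  obtain ⟨j, hj⟩ : ∃ j, v j < w j := by
    by_contra! hle
    exact hne (funext fun j =>
      ((Finset.sum_eq_sum_iff_of_le fun j _ => hle j).1 hsum.symm j (Finset.mem_univ j)).symm)
  have hji : j ≠ i := by
    rintro rfl
    omega
  refine ⟨fun l => if l = i then v i - 1 else if l = j then v j + 1 else v l, ?_, ?_⟩
  · have hi_mem : i ∈ (Finset.univ : Finset ι) := Finset.mem_univ i
    have hj_mem : j ∈ (Finset.univ : Finset ι).erase i := by simp [hji]
    rw [← Finset.add_sum_erase _ _ hi_mem, ← Finset.add_sum_erase _ _ hj_mem,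
      ← Finset.add_sum_erase _ v hi_mem, ← Finset.add_sum_erase _ v hj_mem]
    have hrest : ∑ l ∈ (Finset.univ.erase i).erase j,
        (if l = i then v i - 1 else if l = j then v j + 1 else v l) =
        ∑ l ∈ (Finset.univ.erase i).erase j, v l := by
      refine Finset.sum_congr rfl fun l hl => ?_
      simp only [Finset.mem_erase] at hl
      simp [hl.1, hl.2.1]
    rw [hrest]
    simp only [if_true, if_neg hji]
    omega
  · obtain ⟨l, hl⟩ := exists_eq_ciSup_of_finite (f := fun l =>
      a l * ((if l = i then v i - 1 else if l = j then v j + 1 else v l : ℕ) : ℝ))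
    rw [← hl]
    split_ifs with h1 h2
    · subst h1
      exact mul_lt_mul_of_pos_left (by exact_mod_cast Nat.sub_lt hvi one_pos) (hpos l)
    · subst h2
      refine lt_of_le_of_lt ?_ (hw l hji)
      exact mul_le_mul_of_nonneg_left (by exact_mod_cast hj) (hpos l).le
    · exact hv l h1

/-- For rationally independent positive `a : Fin n → ℝ` (`n ≥ 1`) and every
`k : ℕ`, there is exactly one tuple `v ∈ (ℤ≥0)ⁿ` with `∑ v i = k` minimizing
`max_i (a i * v i)` over all such tuples. -/
theorem stmt_0 (n : ℕ) (hn : 1 ≤ n) (a : Fin n → ℝ) (hpos : ∀ i, 0 < a i)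
    (hind : LinearIndependent ℚ a) (k : ℕ) :
    ∃! v : Fin n → ℕ, (∑ i, v i = k) ∧
      ∀ w : Fin n → ℕ, (∑ i, w i = k) →
        (⨆ i, a i * (v i : ℝ)) ≤ ⨆ i, a i * (w i : ℝ) := by
  have : Nonempty (Fin n) := ⟨⟨0, hn⟩⟩
  have le_sup (v : Fin n → ℕ) (i : Fin n) : a i * (v i : ℝ) ≤ ⨆ i, a i * (v i : ℝ) :=
    le_ciSup (f := fun i => a i * (v i : ℝ)) (Set.finite_range _).bddAbove i
  refine existsUnique_of_exists_of_unique ?_ ?_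
  · have hfin : (Finset.piAntidiag (Finset.univ : Finset (Fin n)) k).Nonempty :=
      ⟨Pi.single ⟨0, hn⟩ k, by simp⟩
    obtain ⟨v, hv, hmin⟩ := Finset.exists_min_image _
      (fun v : Fin n → ℕ => ⨆ i, a i * (v i : ℝ)) hfin
    exact ⟨v, by simpa using hv, fun w hw => hmin w (by simpa using hw)⟩
  · rintro v w ⟨hvk, hv⟩ ⟨hwk, hw⟩
    by_contra hne
    have hvw : ⨆ i, a i * (v i : ℝ) = ⨆ i, a i * (w i : ℝ) := le_antisymm (hv w hwk) (hw v hvk)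
    obtain ⟨i, hi⟩ := exists_eq_ciSup_of_finite (f := fun i => a i * (v i : ℝ))
    obtain ⟨j, hj⟩ := exists_eq_ciSup_of_finite (f := fun i => a i * (w i : ℝ))
    have hvi : 0 < v i := by
      by_contra! h0
      have hv0 : ∀ l, v l = 0 := fun l => by
        by_contra hl
        have h1 := le_sup v l
        rw [← hi, Nat.le_zero.1 h0, Nat.cast_zero, mul_zero] at h1
        exact h1.not_gt (mul_pos (hpos l) (by exact_mod_cast Nat.pos_of_ne_zero hl))
      have hw0 : ∀ l, w l = 0 := by
        have : ∑ l, w l = 0 := by rw [hwk, ← hvk]; simp [hv0]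
        simpa using this
      exact hne (funext fun l => (hv0 l).trans (hw0 l).symm)
    obtain ⟨rfl, hvwi⟩ := hind.eq_of_mul_natCast_eq hvi (hi.trans (hvw.trans hj.symm))
    have strict (u : Fin n → ℕ) (hu : ⨆ l, a l * (u l : ℝ) = ⨆ l, a l * (v l : ℝ))
        (l : Fin n) (hl : l ≠ i) : a l * (u l : ℝ) < a i * (v i : ℝ) := by
      refine lt_of_le_of_ne ((le_sup u l).trans (hu.trans hi.symm).le) fun heq => ?_
      exact hl (hind.eq_of_mul_natCast_eq hvi heq.symm).1.symm
    obtain ⟨u, hu, hlt⟩ := exists_sum_eq_iSup_mul_lt hpos (hvk.trans hwk.symm) hne hvi hvwi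
      (strict v rfl) (strict w hvw.symm)
    exact (hv u (hu.trans hvk)).not_gt (hlt.trans_eq hi)
end

section
/- Let n ≥ 1 and let a = (a₁,…,aₙ) be positive real numbers that are rationally independent, and let k ∈ ℕ. A tuple v ∈ (ℤ≥0)ⁿ admissible at level k satisfies v = Γ^a_k if and only if a_j(v_j + 1) > a_i v_i for all 1 ≤ i, j ≤ n. -/
/-- Positive natural multiples of two distinct members of a rationally independent family differ. -/
lemma LinearIndependent.mul_natCast_ne {ι : Type*} {a : ι → ℝ} (hind : LinearIndependent ℚ a)
    {i j : ι} (hij : i ≠ j) {p q : ℕ} (hq : q ≠ 0) : a i * (p : ℝ) ≠ a j * (q : ℝ) := by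
  intro h
  have hpair : LinearIndependent ℚ ![a i, a j] := by
    have hinj : Function.Injective ![i, j] := by
      intro x y hxy
      fin_cases x <;> fin_cases y <;> simp_all [eq_comm]
    convert hind.comp _ hinj using 1
    ext x
    fin_cases x <;> rfl
  have := LinearIndependent.pair_iff.mp hpair (p : ℚ) (-(q : ℚ)) (by
    simp only [Rat.smul_def]
    push_cast
    linarith)
  exact hq (by simpa using this.2)

/-- With `Γ` the unique admissible minimizer at level `k`, an admissible
tuple `v` equals `Γ` iff `a j * (v j + 1) > a i * v i` for all `i, j`. -/
theorem stmt_1 (n : ℕ) (hn : 1 ≤ n) (a : Fin n → ℝ) (hpos : ∀ i, 0 < a i)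
    (hind : LinearIndependent ℚ a) (k : ℕ)
    (Γ : Fin n → ℕ) (hΓsum : ∑ i, Γ i = k)
    (hΓmin : ∀ w : Fin n → ℕ, ∑ i, w i = k →
      (⨆ i, a i * (Γ i : ℝ)) ≤ ⨆ i, a i * (w i : ℝ))
    (v : Fin n → ℕ) (hvsum : ∑ i, v i = k) :
    v = Γ ↔ ∀ i j : Fin n, a i * (v i : ℝ) < a j * ((v j : ℝ) + 1) := by
  have : Nonempty (Fin n) := ⟨⟨0, hn⟩⟩
  have hle (w : Fin n → ℕ) (i : Fin n) : a i * (w i : ℝ) ≤ ⨆ i, a i * (w i : ℝ) :=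
    le_ciSup (f := fun i => a i * (w i : ℝ)) (Set.finite_range _).bddAbove i
  have hattained (w : Fin n → ℕ) : ∃ i, a i * (w i : ℝ) = ⨆ i, a i * (w i : ℝ) :=
    exists_eq_ciSup_of_finite (f := fun i => a i * (w i : ℝ))
  constructor
  · rintro rfl i j
    by_contra! hij
    obtain ⟨m, hm⟩ := hattained v
    have hmj : a j * ((v j : ℝ) + 1) ≤ a m * (v m : ℝ) := hij.trans (hm ▸ hle v i)
    have hne : m ≠ j := by
      rintro rfl
      linarith [hpos m]
    have hmpos : 0 < a m * (v m : ℝ) := lt_of_lt_of_le (mul_pos (hpos j) (by positivity)) hmj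
    have hvm : 1 ≤ v m := by
      by_contra! h
      simp [Nat.lt_one_iff.mp h] at hmpos
    have hlt : a j * ((v j : ℝ) + 1) < a m * (v m : ℝ) := by
      refine lt_of_le_of_ne hmj fun h => ?_
      exact hind.mul_natCast_ne hne (p := v m) (Nat.succ_ne_zero (v j)) (by push_cast; exact h.symm)
    let w : Fin n → ℕ := Function.update (Function.update v m (v m - 1)) j (v j + 1)
    have hwsum : ∑ i, w i = k := by
      have hsplit (u : Fin n → ℕ) :
          ∑ i, u i = u j + (u m + ∑ i ∈ (Finset.univ.erase j).erase m, u i) := by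
        rw [Finset.add_sum_erase _ _ (by simp [hne]), Finset.add_sum_erase _ _ (by simp)]
      have hrest : ∑ i ∈ (Finset.univ.erase j).erase m, w i =
          ∑ i ∈ (Finset.univ.erase j).erase m, v i := by
        refine Finset.sum_congr rfl fun x hx => ?_
        simp only [Finset.mem_erase] at hx
        simp [w, hx.1, hx.2.1]
      have hwj : w j = v j + 1 := by simp [w]
      have hwm : w m = v m - 1 := by simp [w, hne]
      rw [← hΓsum, hsplit w, hsplit v, hrest, hwj, hwm]
      omega
    obtain ⟨l, hl⟩ := hattained w
    have hmin := hΓmin w hwsum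
    rw [← hl, ← hm] at hmin
    refine absurd hmin (not_le.mpr ?_)
    by_cases hlj : l = j
    · subst hlj
      simpa [w] using hlt
    by_cases hlm : l = m
    · subst hlm
      simp only [w, Function.update_of_ne hlj, Function.update_self]
      exact mul_lt_mul_of_pos_left (by exact_mod_cast Nat.sub_lt hvm one_pos) (hpos l)
    · simp only [w, Function.update_of_ne hlj, Function.update_of_ne hlm]
      exact lt_of_le_of_ne (hm ▸ hle v l) (hind.mul_natCast_ne hlm (by omega))
  · intro h
    by_contra hne
    obtain ⟨j, hj⟩ : ∃ j, v j < Γ j := by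
      by_contra! hall
      refine hne (funext fun i => ?_)
      exact ((Finset.sum_eq_sum_iff_of_le fun i _ => hall i).mp (hΓsum.trans hvsum.symm) i
        (Finset.mem_univ i)).symm
    obtain ⟨m, hm⟩ := hattained v
    have h₁ : a j * ((v j : ℝ) + 1) ≤ a j * (Γ j : ℝ) :=
      mul_le_mul_of_nonneg_left (by exact_mod_cast hj) (hpos j).le
    linarith [h m j, hle Γ j, hΓmin v hvsum]
end

section
/- Let n ≥ 1 and let a = (a₁,…,aₙ) be positive real numbers that are rationally independent. Then for every k ∈ ℕ, the difference Γ^a_{k+1} − Γ^a_k is a standard basis vector of ℤⁿ; that is, the minimizers Γ^a_0, Γ^a_1, Γ^a_2, … form a unit-step lattice path in (ℤ≥0)ⁿ starting at the origin. -/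
/-- Over a rationally independent family, natural multiples of distinct entries agree only at `0`. -/
theorem LinearIndependent.natCast_eq_zero_of_mul_eq_mul {ι : Type*} [Fintype ι] {a : ι → ℝ}
    (hind : LinearIndependent ℚ a) {i j : ι} (hij : i ≠ j) {p q : ℕ}
    (h : a i * (p : ℝ) = a j * (q : ℝ)) : p = 0 := by
  classical
  have key := Fintype.linearIndependent_iff.mp hind
    (Pi.single i (p : ℚ) - Pi.single j (q : ℚ)) (by
      simp [sub_smul, Finset.sum_sub_distrib, Pi.single_apply, ite_smul, Rat.smul_def]
      linarith) i
  simpa [hij] using key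

/-- Removing a unit from a positive coordinate lowers the coordinate sum by one. -/
theorem sum_update_pred {ι : Type*} [Fintype ι] [DecidableEq ι] {w : ι → ℕ} {j : ι}
    (hj : 0 < w j) : ∑ l, Function.update w j (w j - 1) l + 1 = ∑ l, w l := by
  rw [Finset.sum_update_of_mem (Finset.mem_univ j), ← Finset.add_sum_erase _ w (Finset.mem_univ j),
    Finset.sdiff_singleton_eq_erase]
  omega

/-- Adding a unit to a coordinate raises the coordinate sum by one. -/
theorem sum_update_succ {ι : Type*} [Fintype ι] [DecidableEq ι] (w : ι → ℕ) (i : ι) :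
    ∑ l, Function.update w i (w i + 1) l = ∑ l, w l + 1 := by
  rw [Finset.sum_update_of_mem (Finset.mem_univ i), ← Finset.add_sum_erase _ w (Finset.mem_univ i),
    Finset.sdiff_singleton_eq_erase]
  omega

/-- If `v` minimizes the weighted maximum at its level, then raising any coordinate of `v` by one
exceeds that maximum. -/
theorem iSup_lt_mul_succ_of_minimal {ι : Type*} [Fintype ι] [Nonempty ι] {a : ι → ℝ}
    (hpos : ∀ i, 0 < a i) (hind : LinearIndependent ℚ a) {v : ι → ℕ}
    (hmin : ∀ w : ι → ℕ, ∑ i, w i = ∑ i, v i →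
      (⨆ i, a i * (v i : ℝ)) ≤ ⨆ i, a i * (w i : ℝ)) (i : ι) :
    (⨆ l, a l * (v l : ℝ)) < a i * (v i + 1) := by
  classical
  by_contra! hle
  obtain ⟨j, hj⟩ := exists_eq_ciSup_of_finite (f := fun l => a l * (v l : ℝ))
  have hub : ∀ l, a l * (v l : ℝ) ≤ ⨆ l, a l * (v l : ℝ) := fun l =>
    le_ciSup (f := fun l => a l * (v l : ℝ)) (Set.finite_range _).bddAbove l
  rw [← hj] at hle hub
  have hij : i ≠ j := by
    rintro rfl
    linarith [hpos i]
  have hvj : 0 < v j := by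
    rcases Nat.eq_zero_or_pos (v j) with h0 | h0
    · have : 0 < a i * ((v i : ℝ) + 1) := mul_pos (hpos i) (by positivity)
      simp only [h0, Nat.cast_zero, mul_zero] at hle
      linarith
    · exact h0
  set u := Function.update v i (v i + 1) with hu
  have huj : u j = v j := Function.update_of_ne hij.symm _ _
  have hsum : ∑ l, Function.update u j (u j - 1) l = ∑ l, v l := by
    have h1 := sum_update_pred (w := u) (j := j) (by omega)
    have h2 := sum_update_succ v i
    rw [← hu] at h2
    omega
  have hlt : ∀ l, a l * (Function.update u j (u j - 1) l : ℝ) < a j * v j := by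
    intro l
    by_cases hlj : l = j
    · subst hlj
      rw [Function.update_self, huj]
      exact mul_lt_mul_of_pos_left (by exact_mod_cast Nat.sub_lt hvj one_pos) (hpos l)
    rw [Function.update_of_ne hlj]
    have hne : a l * (u l : ℝ) ≠ a j * v j := fun h =>
      hvj.ne' (hind.natCast_eq_zero_of_mul_eq_mul (Ne.symm hlj) h.symm)
    refine lt_of_le_of_ne ?_ hne
    by_cases hli : l = i
    · subst hli
      simpa [hu] using hle
    · rw [hu, Function.update_of_ne hli]
      exact hub l
  obtain ⟨m, hm⟩ := exists_eq_ciSup_of_finite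
    (f := fun l => a l * (Function.update u j (u j - 1) l : ℝ))
  have hge := hmin _ hsum
  rw [← hm, ← hj] at hge
  exact absurd (hlt m) (not_lt.mpr hge)

/-- The minimizers `Γ k` form a unit-step lattice path in `(ℤ≥0)ⁿ`
starting at the origin: each difference `Γ (k+1) - Γ k` is a standard basis vector. -/
theorem stmt_2 (n : ℕ) (hn : 1 ≤ n) (a : Fin n → ℝ) (hpos : ∀ i, 0 < a i)
    (hind : LinearIndependent ℚ a)
    (Γ : ℕ → Fin n → ℕ) (hsum : ∀ k, ∑ i, Γ k i = k)
    (hmin : ∀ k, ∀ w : Fin n → ℕ, ∑ i, w i = k →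
      (⨆ i, a i * (Γ k i : ℝ)) ≤ ⨆ i, a i * (w i : ℝ)) :
    Γ 0 = 0 ∧ ∀ k, ∃ i : Fin n, Γ (k + 1) = Γ k + Pi.single i 1 := by
  have : Nonempty (Fin n) := ⟨⟨0, hn⟩⟩
  refine ⟨funext fun i => by simpa using Finset.sum_eq_zero_iff.mp (hsum 0) i, fun k => ?_⟩
  have hbdd : ∀ w : Fin n → ℕ, BddAbove (Set.range fun l => a l * (w l : ℝ)) := fun w =>
    (Set.finite_range _).bddAbove
  have hmono : (⨆ i, a i * (Γ k i : ℝ)) ≤ ⨆ i, a i * (Γ (k + 1) i : ℝ) := by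
    obtain ⟨l, hl⟩ : ∃ l, 0 < Γ (k + 1) l := by
      by_contra! h
      have := hsum (k + 1)
      rw [Finset.sum_eq_zero fun i _ => Nat.le_zero.mp (h i)] at this
      omega
    have hs := (sum_update_pred hl).trans (hsum (k + 1))
    refine (hmin k _ (Nat.succ_injective hs)).trans (ciSup_mono (hbdd _) fun i => ?_)
    refine mul_le_mul_of_nonneg_left ?_ (hpos i).le
    exact_mod_cast update_le_self_iff.mpr (Nat.sub_le _ 1) i
  have hle : ∀ i, Γ k i ≤ Γ (k + 1) i := by
    intro i
    by_contra! h
    have h1 := iSup_lt_mul_succ_of_minimal hpos hind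
      (fun w hw => hmin (k + 1) w (hw.trans (hsum _))) i
    have h2 : a i * ((Γ (k + 1) i : ℝ) + 1) ≤ a i * Γ k i :=
      mul_le_mul_of_nonneg_left (by exact_mod_cast h) (hpos i).le
    have h3 := le_ciSup (hbdd (Γ k)) i
    linarith
  obtain ⟨i, hi⟩ : ∃ i, Γ k i < Γ (k + 1) i := by
    by_contra! h
    have h1 := Finset.sum_le_sum fun i (_ : i ∈ Finset.univ) => h i
    rw [hsum, hsum] at h1
    omega
  have hstep : ∀ l, (Γ k + Pi.single i 1 : Fin n → ℕ) l ≤ Γ (k + 1) l := by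
    intro l
    by_cases hl : l = i
    · subst hl
      simpa using hi
    · simpa [hl] using hle l
  have hsums : ∑ l, (Γ k + Pi.single i 1 : Fin n → ℕ) l = ∑ l, Γ (k + 1) l := by
    simp [Finset.sum_add_distrib, hsum]
  exact ⟨i, funext fun l =>
    ((Finset.sum_eq_sum_iff_of_le fun l _ => hstep l).mp hsums l (Finset.mem_univ l)).symm⟩
end

section
/- Let n ≥ 1 and let a = (a₁,…,aₙ) be positive real numbers that are rationally independent. Then the sequence k ↦ Γ^a_k is the unique sequence v : ℕ → (ℤ≥0)ⁿ such that v(0) = 0, v(k+1) − v(k) is a standard basis vector of ℤⁿ for every k ∈ ℕ, and a_j((v(k))_j + 1) > a_i (v(k))_i for every k ∈ ℕ and all 1 ≤ i, j ≤ n. -/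
/-- A tuple `v` is weight-balanced with respect to `a` if
`a i * v i < a j * (v j + 1)` for all `i, j`. -/
def WeightBalanced {ι : Type*} (a : ι → ℝ) (v : ι → ℕ) : Prop :=
  ∀ i j, a i * (v i : ℝ) < a j * ((v j : ℝ) + 1)

/-- Weight-balanced tuples are monotone in their level. -/
theorem WeightBalanced.le_of_sum_le {ι : Type*} [Fintype ι] {a : ι → ℝ} (hpos : ∀ i, 0 < a i)
    {v w : ι → ℕ} (hv : WeightBalanced a v) (hw : WeightBalanced a w)
    (h : ∑ i, v i ≤ ∑ i, w i) : v ≤ w := by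
  by_contra hle
  obtain ⟨i, hi⟩ : ∃ i, w i < v i := by simpa [Pi.le_def] using hle
  obtain ⟨j, hj⟩ : ∃ j, v j < w j := by
    by_contra! hall
    exact absurd (Finset.sum_lt_sum (fun j _ => hall j) ⟨i, Finset.mem_univ i, hi⟩) (by omega)
  have hi' : (w i : ℝ) + 1 ≤ v i := by exact_mod_cast hi
  have hj' : (v j : ℝ) + 1 ≤ w j := by exact_mod_cast hj
  exact lt_irrefl _ <| calc
    a i * (v i : ℝ) < a j * ((v j : ℝ) + 1) := hv i j
    _ ≤ a j * (w j : ℝ) := mul_le_mul_of_nonneg_left hj' (hpos j).le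
    _ < a i * ((w i : ℝ) + 1) := hw j i
    _ ≤ a i * (v i : ℝ) := mul_le_mul_of_nonneg_left hi' (hpos i).le

/-- Natural multiples of distinct members of a rationally independent family agree only at zero. -/
theorem LinearIndependent.eq_zero_of_mul_natCast_eq {ι : Type*} {a : ι → ℝ}
    (hind : LinearIndependent ℚ a) {i j : ι} (hij : i ≠ j) {p q : ℕ}
    (h : a i * (p : ℝ) = a j * (q : ℝ)) : p = 0 := by
  have hpair := (LinearIndepOn.pair_iff a hij).1 (hind.linearIndepOn _) (p : ℚ) (-(q : ℚ)) (by
    simp only [Rat.smul_def]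
    push_cast
    linarith)
  exact_mod_cast hpair.1

/-- A tuple minimizing `⨆ i, a i * v i` at its level is weight-balanced. -/
theorem weightBalanced_of_forall_iSup_le {ι : Type*} [Fintype ι] {a : ι → ℝ}
    (hpos : ∀ i, 0 < a i) (hind : LinearIndependent ℚ a) {v : ι → ℕ}
    (hmin : ∀ w : ι → ℕ, ∑ i, w i = ∑ i, v i →
      (⨆ i, a i * (v i : ℝ)) ≤ ⨆ i, a i * (w i : ℝ)) : WeightBalanced a v := by
  classical
  intro i j
  by_contra! hij
  have : Nonempty ι := ⟨i⟩
  obtain ⟨m, hm⟩ := Finite.exists_max fun l => a l * (v l : ℝ)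
  have hmj : a j * ((v j : ℝ) + 1) ≤ a m * (v m : ℝ) := hij.trans (hm i)
  have hne : m ≠ j := by
    rintro rfl
    linarith [hpos m]
  have hvm : 0 < v m := by
    by_contra! h0
    have : 0 < a j * ((v j : ℝ) + 1) := mul_pos (hpos j) (by positivity)
    simp only [nonpos_iff_eq_zero.1 h0, Nat.cast_zero, mul_zero] at hmj
    linarith
  have hmj' : a j * ((v j : ℝ) + 1) < a m * (v m : ℝ) := by
    refine hmj.lt_of_ne fun h => ?_
    have h0 := hind.eq_zero_of_mul_natCast_eq hne.symm (p := v j + 1) (q := v m)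
      (by push_cast; exact h)
    omega
  let w : ι → ℕ := Function.update (Function.update v m (v m - 1)) j (v j + 1)
  have hwj : w j = v j + 1 := by simp [w]
  have hwm : w m = v m - 1 := by simp [w, hne]
  have hw {l : ι} (hlj : l ≠ j) (hlm : l ≠ m) : w l = v l := by simp [w, hlj, hlm]
  have hsum : ∑ l, w l = ∑ l, v l := by
    have hadd : w + Pi.single m 1 = v + Pi.single j 1 := by
      ext l
      by_cases hlj : l = j
      · subst hlj
        simp [hwj, hne.symm]
      by_cases hlm : l = m
      · subst hlm
        simp [hwm, hne, Nat.sub_add_cancel hvm]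
      simp [hw hlj hlm, hlj, hlm]
    have := congrArg (fun f : ι → ℕ => ∑ l, f l) hadd
    simpa [Finset.sum_add_distrib] using this
  obtain ⟨l, hl⟩ := Finite.exists_max fun l => a l * (w l : ℝ)
  have hlt : a l * (w l : ℝ) < a m * (v m : ℝ) := by
    by_cases hlj : l = j
    · rw [hlj, hwj]
      exact_mod_cast hmj'
    by_cases hlm : l = m
    · rw [hlm, hwm]
      exact mul_lt_mul_of_pos_left (by exact_mod_cast Nat.sub_lt hvm one_pos) (hpos m)
    rw [hw hlj hlm]
    refine (hm l).lt_of_ne fun h => ?_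
    exact hvm.ne' (hind.eq_zero_of_mul_natCast_eq (Ne.symm hlm) h.symm)
  have h₁ : a m * (v m : ℝ) ≤ ⨆ i, a i * (v i : ℝ) :=
    le_ciSup (f := fun i => a i * (v i : ℝ)) (Set.finite_range _).bddAbove m
  have h₂ : (⨆ i, a i * (w i : ℝ)) ≤ a l * (w l : ℝ) := ciSup_le hl
  linarith [hmin w hsum]

/-- Comparable tuples of natural numbers on consecutive levels differ by a basis vector. -/
theorem exists_eq_add_single_of_le {ι : Type*} [Fintype ι] [DecidableEq ι] {v w : ι → ℕ}
    (hle : v ≤ w) (hsum : ∑ i, w i = ∑ i, v i + 1) : ∃ i, w = v + Pi.single i 1 := by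
  obtain ⟨d, rfl⟩ := exists_add_of_le hle
  have hd : ∑ i, d i = 1 := by
    simpa [Finset.sum_add_distrib] using hsum
  obtain ⟨i, -, hi⟩ := Finset.exists_ne_zero_of_sum_ne_zero (by omega : ∑ i, d i ≠ 0)
  have hsplit := Finset.add_sum_erase Finset.univ d (Finset.mem_univ i)
  refine ⟨i, congrArg (v + ·) (funext fun l => ?_)⟩
  by_cases hl : l = i
  · subst hl
    simp only [Pi.single_eq_same]
    omega
  · have := Finset.single_le_sum (f := d) (fun _ _ => Nat.zero_le _)
      (Finset.mem_erase.2 ⟨hl, Finset.mem_univ l⟩)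
    simp only [Pi.single_eq_of_ne hl]
    omega


/-- The sequence of minimizers `k ↦ Γ k` is the unique sequence
`v : ℕ → (ℤ≥0)ⁿ` with `v 0 = 0`, unit steps, and `a j * (v k j + 1) > a i * (v k i)`
for all `k` and all `i, j`. -/
theorem stmt_3 (n : ℕ) (hn : 1 ≤ n) (a : Fin n → ℝ) (hpos : ∀ i, 0 < a i)
    (hind : LinearIndependent ℚ a)
    (Γ : ℕ → Fin n → ℕ) (hsum : ∀ k, ∑ i, Γ k i = k)
    (hmin : ∀ k, ∀ w : Fin n → ℕ, ∑ i, w i = k →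
      (⨆ i, a i * (Γ k i : ℝ)) ≤ ⨆ i, a i * (w i : ℝ)) :
    (Γ 0 = 0 ∧ (∀ k, ∃ i : Fin n, Γ (k + 1) = Γ k + Pi.single i 1) ∧
      ∀ k, ∀ i j : Fin n, a i * (Γ k i : ℝ) < a j * ((Γ k j : ℝ) + 1)) ∧
    ∀ v : ℕ → Fin n → ℕ,
      (v 0 = 0 ∧ (∀ k, ∃ i : Fin n, v (k + 1) = v k + Pi.single i 1) ∧
        ∀ k, ∀ i j : Fin n, a i * (v k i : ℝ) < a j * ((v k j : ℝ) + 1)) →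
      v = Γ := by
  have hbal (k : ℕ) : WeightBalanced a (Γ k) :=
    weightBalanced_of_forall_iSup_le hpos hind fun w hw => hmin k w (hw.trans (hsum k))
  refine ⟨⟨?_, fun k => ?_, hbal⟩, ?_⟩
  · ext i
    simpa using Finset.sum_eq_zero_iff.1 (hsum 0) i (Finset.mem_univ i)
  · refine exists_eq_add_single_of_le ((hbal k).le_of_sum_le hpos (hbal (k + 1)) ?_) ?_ <;>
      simp [hsum]
  · rintro v ⟨hv0, hstep, hv⟩
    have hvsum (k : ℕ) : ∑ i, v k i = k := by
      induction k with
      | zero => simp [hv0]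
      | succ k ih =>
        obtain ⟨i, hi⟩ := hstep k
        simp [hi, Finset.sum_add_distrib, ih]
    funext k
    have hvk : WeightBalanced a (v k) := hv k
    exact le_antisymm (hvk.le_of_sum_le hpos (hbal k) (by rw [hvsum, hsum]))
      ((hbal k).le_of_sum_le hpos hvk (by rw [hvsum, hsum]))
end

section
/- Let a > 0 be irrational. Then for every k ∈ ℕ, the greedy lattice path satisfies g^a(k) = Γ^{(1,a)}_k; that is, g^a(k) is the unique pair (v₁, v₂) ∈ (ℤ≥0)² with v₁ + v₂ = k minimizing max(v₁, a·v₂) over all such pairs. -/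
/-- The greedy lattice path `g^a : ℕ → (ℤ≥0)²`: start at `(0,0)` and step to the
right whenever `a * (y + 1) ≥ x + 1`, otherwise step up. -/
noncomputable def greedy (a : ℝ) : ℕ → ℕ × ℕ
  | 0 => (0, 0)
  | k + 1 =>
    if ((greedy a k).1 + 1 : ℝ) ≤ a * ((greedy a k).2 + 1)
    then ((greedy a k).1 + 1, (greedy a k).2)
    else ((greedy a k).1, (greedy a k).2 + 1)

theorem greedy_add (a : ℝ) (k : ℕ) : (greedy a k).1 + (greedy a k).2 = k := by
  induction k with
  | zero => simp [greedy]
  | succ k ih =>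
    rw [greedy]
    split_ifs
    · simp only; omega
    · simp only; omega

theorem greedy_bounds {a : ℝ} (ha : 0 < a) (k : ℕ) :
    a * (greedy a k).2 < (greedy a k).1 + 1 ∧ (greedy a k).1 ≤ a * ((greedy a k).2 + 1) := by
  induction k with
  | zero => simp [greedy, ha.le]
  | succ k ih =>
    rw [greedy]
    split_ifs with h
    · push_cast
      exact ⟨by linarith, h⟩
    · push_cast
      exact ⟨not_le.mp h, by linarith⟩

theorem greedy_max_lt {a : ℝ} (ha : 0 < a) (hirr : Irrational a) {k : ℕ} {w : ℕ × ℕ}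
    (hw : w.1 + w.2 = k) (hne : w ≠ greedy a k) :
    max ((greedy a k).1 : ℝ) (a * (greedy a k).2) < max (w.1 : ℝ) (a * w.2) := by
  have hsum := greedy_add a k
  obtain ⟨hy, hx⟩ := greedy_bounds ha k
  have hx' : ((greedy a k).1 : ℝ) < a * ((greedy a k).2 + 1) := by
    refine lt_of_le_of_ne hx fun h ↦ ?_
    have h_irr := hirr.mul_natCast (Nat.succ_ne_zero (greedy a k).2)
    push_cast at h_irr
    exact h_irr.ne_nat _ h.symm
  rcases lt_trichotomy w.1 (greedy a k).1 with h | h | h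
  · have h2 : ((greedy a k).2 + 1 : ℝ) ≤ w.2 := by
      exact_mod_cast (by omega : (greedy a k).2 + 1 ≤ w.2)
    have h3 := mul_le_mul_of_nonneg_left h2 ha.le
    exact lt_max_of_lt_right (max_lt (by linarith) (by linarith))
  · exact absurd (Prod.ext h (by omega)) hne
  · have h1 : ((greedy a k).1 + 1 : ℝ) ≤ w.1 := by exact_mod_cast h
    exact lt_max_of_lt_left (max_lt (by linarith) (by linarith))

/-- For irrational `a > 0`, `greedy a k` is the unique pair
`(v₁, v₂) ∈ (ℤ≥0)²` with `v₁ + v₂ = k` minimizing `max v₁ (a * v₂)`. -/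
theorem stmt_4 (a : ℝ) (ha : 0 < a) (hirr : Irrational a) (k : ℕ) :
    ((greedy a k).1 + (greedy a k).2 = k ∧
      ∀ w : ℕ × ℕ, w.1 + w.2 = k →
        max ((greedy a k).1 : ℝ) (a * (greedy a k).2) ≤ max (w.1 : ℝ) (a * w.2)) ∧
    ∀ v : ℕ × ℕ, v.1 + v.2 = k →
      (∀ w : ℕ × ℕ, w.1 + w.2 = k →
        max (v.1 : ℝ) (a * v.2) ≤ max (w.1 : ℝ) (a * w.2)) →
      v = greedy a k := by
  refine ⟨⟨greedy_add a k, fun w hw ↦ ?_⟩, fun v hv hmin ↦ ?_⟩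
  · rcases eq_or_ne w (greedy a k) with rfl | hne
    · exact le_rfl
    · exact (greedy_max_lt ha hirr hw hne).le
  · by_contra hne
    exact (greedy_max_lt ha hirr hv hne).not_ge (hmin _ (greedy_add a k))
end

section
/- Let a > 0 and write g^a(k) = (x_k, y_k) for the greedy lattice path. Then the infimum of the set { (y_k + 1)/x_k : k ≥ 1, x_k > 0 } of slopes of lines joining (0,−1) to points of the path equals 1/a. -/
theorem greedy_fst_le (a : ℝ) (ha : 0 < a) (k : ℕ) :
    ((greedy a k).1 : ℝ) ≤ a * ((greedy a k).2 + 1) := by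
  induction k with
  | zero => simpa [greedy] using ha.le
  | succ k ih =>
    rw [greedy]
    split_ifs with h
    · exact_mod_cast h
    · push_cast
      nlinarith

/-- From a point `(x, y)` the greedy path runs right along height `y` through `(x + d, y)`
as long as that point stays on or above the line. -/
theorem greedy_add_of_le (a : ℝ) {k x y : ℕ} (hk : greedy a k = (x, y)) (d : ℕ)
    (hd : ((x + d : ℕ) : ℝ) ≤ a * (y + 1)) : greedy a (k + d) = (x + d, y) := by
  induction d with
  | zero => simpa using hk
  | succ d ih =>
    push_cast at hd ih
    have h := ih (by linarith)
    rw [← add_assoc, greedy, h, if_pos (by push_cast; linarith)]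
    rfl

/-- At each height `y` the greedy path visits the rightmost admissible lattice point. -/
theorem exists_greedy_eq_floor (a : ℝ) (ha : 0 < a) (y : ℕ) :
    ∃ k, greedy a k = (⌊a * (y + 1)⌋₊, y) := by
  induction y with
  | zero =>
    refine ⟨0 + ⌊a * ((0 : ℕ) + 1)⌋₊, ?_⟩
    have h := greedy_add_of_le a (k := 0) (x := 0) (y := 0) rfl ⌊a * ((0 : ℕ) + 1)⌋₊
      (by rw [zero_add]; exact Nat.floor_le (by positivity))
    simpa using h
  | succ y ih =>
    obtain ⟨k, hk⟩ := ih
    have hup : greedy a (k + 1) = (⌊a * (y + 1)⌋₊, y + 1) := by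
      rw [greedy, hk, if_neg (not_le.mpr (Nat.lt_floor_add_one _))]
    have hle : ⌊a * (y + 1)⌋₊ ≤ ⌊a * ((y + 1 : ℕ) + 1)⌋₊ :=
      Nat.floor_le_floor (by push_cast; nlinarith)
    obtain ⟨d, hd⟩ := Nat.exists_eq_add_of_le hle
    refine ⟨k + 1 + d, ?_⟩
    rw [hd]
    refine greedy_add_of_le a hup d ?_
    rw [← hd]
    exact Nat.floor_le (by positivity)

/-- The infimum of the slopes `(y_k + 1) / x_k` of lines joining
`(0, -1)` to points of the greedy path (with `x_k > 0`, `k ≥ 1`) equals `1 / a`. -/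
theorem stmt_6 (a : ℝ) (ha : 0 < a) :
    sInf {s : ℝ | ∃ k : ℕ, 1 ≤ k ∧ 0 < (greedy a k).1 ∧
      s = (((greedy a k).2 : ℝ) + 1) / ((greedy a k).1 : ℝ)} = 1 / a := by
  have below : ∀ w, 1 / a < w → ∃ s ∈ {s : ℝ | ∃ k : ℕ, 1 ≤ k ∧ 0 < (greedy a k).1 ∧
      s = (((greedy a k).2 : ℝ) + 1) / ((greedy a k).1 : ℝ)}, s < w := by
    intro w hw
    have hw0 : 0 < w := (one_div_pos.mpr ha).trans hw
    have hwa : 0 < w * a - 1 := sub_pos.mpr ((div_lt_iff₀ ha).mp hw)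
    obtain ⟨y, hy⟩ := exists_nat_gt (w / (w * a - 1))
    rw [div_lt_iff₀ hwa] at hy
    obtain ⟨k, hk⟩ := exists_greedy_eq_floor a ha y
    have hfl : a * (y + 1) < ⌊a * ((y : ℝ) + 1)⌋₊ + 1 := Nat.lt_floor_add_one _
    have hlt : (y : ℝ) + 1 < w * ⌊a * ((y : ℝ) + 1)⌋₊ := by
      have := mul_lt_mul_of_pos_left hfl hw0
      nlinarith
    have hpos : (0 : ℝ) < ⌊a * ((y : ℝ) + 1)⌋₊ :=
      pos_of_mul_pos_right ((by positivity : (0 : ℝ) < y + 1).trans hlt) hw0.le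
    refine ⟨_, ⟨k, ?_, ?_, rfl⟩, ?_⟩
    · rw [Nat.one_le_iff_ne_zero]
      rintro rfl
      have h0 : 0 = ⌊a * ((y : ℝ) + 1)⌋₊ := congrArg Prod.fst hk
      rw [← h0] at hpos
      simp at hpos
    · rw [hk]
      exact_mod_cast hpos
    · rw [hk]
      exact (div_lt_iff₀ hpos).mpr hlt
  refine csInf_eq_of_forall_ge_of_forall_gt_exists_lt ?_ ?_ below
  · obtain ⟨s, hs, -⟩ := below (1 / a + 1) (lt_add_one _)
    exact ⟨s, hs⟩
  · rintro s ⟨k, -, hx, rfl⟩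
    rw [div_le_div_iff₀ ha (by exact_mod_cast hx)]
    linarith [greedy_fst_le a ha k]
end

section
/- Let n ≥ 1, let a = (a₁,…,aₙ) be positive real numbers that are rationally independent, let k ≥ 1, and set M := max_{1≤i≤n} aᵢ(Γ^a_k)ᵢ. Then M = j·aᵢ for some 1 ≤ i ≤ n and some integer j ≥ 1, and the number of pairs (i, j) with 1 ≤ i ≤ n, j ∈ ℤ≥1 and j·aᵢ ≤ M is exactly k. In other words, the minimum of max_i aᵢvᵢ over tuples v ∈ (ℤ≥0)ⁿ with v₁+⋯+vₙ = k equals the k-th smallest element of the multiset { j·aᵢ : 1 ≤ i ≤ n, j ∈ ℤ≥1 }. -/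
/-- Nonzero natural multiples of two distinct members of a `ℚ`-independent family differ. -/
theorem natCast_mul_ne_of_linearIndependent {ι : Type*} {a : ι → ℝ}
    (hind : LinearIndependent ℚ a) {i j : ι} (hij : i ≠ j) {p q : ℕ} (hp : p ≠ 0) :
    (p : ℝ) * a i ≠ q * a j := by
  intro h
  have hpair : LinearIndependent ℚ ![a i, a j] := by
    have hinj : Function.Injective ![i, j] := by
      intro x y hxy
      fin_cases x <;> fin_cases y <;> simp_all
    convert hind.comp _ hinj using 1
    ext x
    fin_cases x <;> rfl
  have h0 := (LinearIndependent.pair_iff.mp hpair (p : ℚ) (-(q : ℚ)) (by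
    simp only [Rat.smul_def]
    push_cast
    linarith)).1
  exact hp (by exact_mod_cast h0)

theorem ncard_setOf_one_le_and_le {ι : Type*} [Fintype ι] (f : ι → ℕ) :
    {p : ι × ℕ | 1 ≤ p.2 ∧ p.2 ≤ f p.1}.ncard = ∑ i, f i := by
  have h : {p : ι × ℕ | 1 ≤ p.2 ∧ p.2 ≤ f p.1} =
      Equiv.sigmaEquivProd ι ℕ ''
        ((Finset.univ.sigma fun i => Finset.Icc 1 (f i) : Finset (Σ _ : ι, ℕ)) :
          Set (Σ _ : ι, ℕ)) := by
    rw [Equiv.image_eq_preimage_symm]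
    ext ⟨i, j⟩
    simp
  rw [h, Set.ncard_image_of_injective _ (Equiv.injective _), Set.ncard_coe_finset]
  simp

/-- The `j`-th multiple of `a l` is at most the maximum of the minimizer `Γ` exactly when
`j ≤ Γ l`. -/
theorem natCast_mul_le_iff_of_minimizer {ι : Type*} [Fintype ι] {a : ι → ℝ}
    (hpos : ∀ i, 0 < a i) (hind : LinearIndependent ℚ a) {Γ : ι → ℕ} {i₀ : ι}
    (hle : ∀ i, a i * (Γ i : ℝ) ≤ a i₀ * Γ i₀) (hi₀ : Γ i₀ ≠ 0)
    (hmin : ∀ w : ι → ℕ, ∑ i, w i = ∑ i, Γ i → ∃ i, a i₀ * (Γ i₀ : ℝ) ≤ a i * w i)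
    (l : ι) (j : ℕ) : (j : ℝ) * a l ≤ a i₀ * Γ i₀ ↔ j ≤ Γ l := by
  classical
  constructor
  · intro hj
    by_contra! hlt
    have hj' : ((Γ l + 1 : ℕ) : ℝ) * a l ≤ a i₀ * Γ i₀ :=
      (mul_le_mul_of_nonneg_right (by exact_mod_cast hlt) (hpos l).le).trans hj
    have hl : l ≠ i₀ := by
      rintro rfl
      push_cast at hj'
      linarith [hpos l]
    obtain ⟨m, hm⟩ := Nat.exists_eq_succ_of_ne_zero hi₀
    have hsum : ∑ i, Function.update (Function.update Γ i₀ m) l (Γ l + 1) i = ∑ i, Γ i := by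
      rw [Finset.sum_update_of_mem (Finset.mem_univ l),
        Finset.sum_update_of_mem (by simpa using hl.symm),
        ← Finset.add_sum_erase _ Γ (Finset.mem_univ l), ← Finset.sdiff_singleton_eq_erase,
        ← Finset.add_sum_erase (Finset.univ \ {l}) Γ (a := i₀) (by simpa using hl.symm),
        ← Finset.sdiff_singleton_eq_erase]
      omega
    obtain ⟨i, hi⟩ := hmin _ hsum
    rcases eq_or_ne i l with rfl | hil
    · rw [Function.update_self] at hi
      refine natCast_mul_ne_of_linearIndependent hind hl (Nat.succ_ne_zero (Γ i))
        (q := Γ i₀) ?_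
      rw [mul_comm (Γ i₀ : ℝ)]
      exact le_antisymm hj' (hi.trans_eq (mul_comm _ _))
    rw [Function.update_of_ne hil] at hi
    rcases eq_or_ne i i₀ with rfl | hii
    · rw [Function.update_self, hm] at hi
      push_cast at hi
      linarith [hpos i]
    rw [Function.update_of_ne hii] at hi
    refine natCast_mul_ne_of_linearIndependent hind hii.symm hi₀ (q := Γ i) ?_
    linarith [hle i]
  · intro hj
    rw [mul_comm]
    exact (mul_le_mul_of_nonneg_left (by exact_mod_cast hj) (hpos l).le).trans (hle l)

/-- With `Γ` the admissible minimizer at level `k ≥ 1` and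
`M = max_i (a i * Γ i)`, we have `M = j * a i` for some `i` and some integer
`j ≥ 1`, and the number of pairs `(i, j)` with `j ≥ 1` and `j * a i ≤ M` is
exactly `k`; i.e. `M` is the `k`-th smallest element of the multiset
`{ j * a i : 1 ≤ i ≤ n, j ≥ 1 }`. -/
theorem stmt_8 (n : ℕ) (hn : 1 ≤ n) (a : Fin n → ℝ) (hpos : ∀ i, 0 < a i)
    (hind : LinearIndependent ℚ a) (k : ℕ) (hk : 1 ≤ k)
    (Γ : Fin n → ℕ) (hΓsum : ∑ i, Γ i = k)
    (hΓmin : ∀ w : Fin n → ℕ, ∑ i, w i = k →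
      (⨆ i, a i * (Γ i : ℝ)) ≤ ⨆ i, a i * (w i : ℝ)) :
    (∃ i : Fin n, ∃ j : ℕ, 1 ≤ j ∧ (⨆ i', a i' * (Γ i' : ℝ)) = (j : ℝ) * a i) ∧
    {p : Fin n × ℕ | 1 ≤ p.2 ∧ (p.2 : ℝ) * a p.1 ≤ ⨆ i', a i' * (Γ i' : ℝ)}.ncard = k := by
  have : Nonempty (Fin n) := ⟨⟨0, hn⟩⟩
  obtain ⟨i₀, hi₀⟩ := exists_eq_ciSup_of_finite (f := fun i => a i * (Γ i : ℝ))
  have hle : ∀ i, a i * (Γ i : ℝ) ≤ a i₀ * Γ i₀ := fun i =>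
    (le_ciSup (Set.finite_range fun i => a i * (Γ i : ℝ)).bddAbove i).trans_eq hi₀.symm
  have hne : Γ i₀ ≠ 0 := by
    intro h0
    have hzero : ∀ i, Γ i = 0 := by
      intro i
      by_contra h
      have h1 : 0 < a i * (Γ i : ℝ) :=
        mul_pos (hpos i) (by exact_mod_cast Nat.pos_of_ne_zero h)
      have h2 := hle i
      rw [h0, Nat.cast_zero, mul_zero] at h2
      exact h2.not_gt h1
    simp only [hzero, Finset.sum_const_zero] at hΓsum
    omega
  have hmin : ∀ w : Fin n → ℕ, ∑ i, w i = ∑ i, Γ i →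
      ∃ i, a i₀ * (Γ i₀ : ℝ) ≤ a i * w i := by
    intro w hw
    obtain ⟨i, hi⟩ := exists_eq_ciSup_of_finite (f := fun i => a i * (w i : ℝ))
    exact ⟨i, hi₀.trans_le ((hΓmin w (hw.trans hΓsum)).trans_eq hi.symm)⟩
  rw [← hi₀]
  refine ⟨⟨i₀, Γ i₀, Nat.one_le_iff_ne_zero.mpr hne, mul_comm _ _⟩, ?_⟩
  simp only [natCast_mul_le_iff_of_minimizer hpos hind hle hne hmin]
  rw [ncard_setOf_one_le_and_le, hΓsum]
end

section
/- Let k ≥ 1 and let a > 0 be a real number not belonging to the set 𝕁_k = { (k−j)/(j+1) : j ∈ ℤ, 0 ≤ j ≤ k }. Then there exists ε > 0 such that Γ^{(1,b)}_k = Γ^{(1,b')}_k for all irrational b, b' ∈ (a−ε, a+ε). That is, as a function of the irrational parameter b, the lattice point Γ^{(1,b)}_k is locally constant away from 𝕁_k. -/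
/-- `v ∈ (ℤ≥0)²` is the (a) minimizer of `max v₁ (b * v₂)` among pairs summing to `k`. -/
def IsMinPair (b : ℝ) (k : ℕ) (v : ℕ × ℕ) : Prop :=
  v.1 + v.2 = k ∧ ∀ w : ℕ × ℕ, w.1 + w.2 = k →
    max (v.1 : ℝ) (b * v.2) ≤ max (w.1 : ℝ) (b * w.2)

/-- If the minimizer for `b` has smaller second coordinate than the minimizer for `b'`, then a
jump value `(k - j) / (j + 1)` lies between `b'` and `b`. -/
theorem IsMinPair.exists_jump_between {k : ℕ} {b b' : ℝ} (hb' : 0 < b') {v w : ℕ × ℕ}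
    (hv : IsMinPair b k v) (hw : IsMinPair b' k w) (hlt : v.2 < w.2) :
    ∃ j : ℕ, j ≤ k ∧ b' ≤ ((k - j : ℕ) : ℝ) / ((j : ℝ) + 1) ∧
      ((k - j : ℕ) : ℝ) / ((j : ℝ) + 1) ≤ b := by
  obtain ⟨v₁, j⟩ := v
  obtain ⟨w₁, m⟩ := w
  obtain ⟨hvk, hv⟩ := hv
  obtain ⟨hwk, hw⟩ := hw
  dsimp only at hvk hwk hlt hv hw
  obtain ⟨u, rfl⟩ : ∃ u, v₁ = u + 1 := ⟨v₁ - 1, by omega⟩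
  obtain ⟨n, rfl⟩ : ∃ n, m = n + 1 := ⟨m - 1, by omega⟩
  have hv' := (le_max_left _ _).trans (hv (u, j + 1) (by dsimp only; omega))
  have hw' := (le_max_right _ _).trans (hw (w₁ + 1, n) (by dsimp only; omega))
  push_cast at hv' hw'
  have hjb : (u : ℝ) + 1 ≤ b * (j + 1) := (le_max_iff.mp hv').resolve_left (by linarith)
  have hnb : b' * (n + 1) ≤ w₁ + 1 := (le_max_iff.mp hw').resolve_right (by nlinarith)
  have hkj : k - j = u + 1 := by omega
  refine ⟨j, by omega, ?_, ?_⟩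
  · rw [hkj, le_div_iff₀ (by positivity)]
    have hjn : (j : ℝ) ≤ n := by exact_mod_cast Nat.lt_succ_iff.mp hlt
    have hwu : (w₁ : ℝ) ≤ u := by exact_mod_cast (by omega : w₁ ≤ u)
    push_cast
    nlinarith
  · rw [hkj, div_le_iff₀ (by positivity)]
    exact_mod_cast hjb

/-- For `k ≥ 1` and `a > 0` not in `𝕁_k = {(k-j)/(j+1) : 0 ≤ j ≤ k}`,
there is `ε > 0` such that `Γ^{(1,b)}_k` is the same for all irrational
`b, b' ∈ (a - ε, a + ε)`. -/
theorem stmt_9 (k : ℕ) (hk : 1 ≤ k) (a : ℝ) (ha : 0 < a)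
    (hJ : a ∉ {x : ℝ | ∃ j : ℕ, j ≤ k ∧ x = ((k - j : ℕ) : ℝ) / ((j : ℝ) + 1)}) :
    ∃ ε > 0, ∀ b b' : ℝ, Irrational b → Irrational b' →
      b ∈ Set.Ioo (a - ε) (a + ε) → b' ∈ Set.Ioo (a - ε) (a + ε) →
      ∀ v w : ℕ × ℕ, IsMinPair b k v → IsMinPair b' k w → v = w := by
  set J := {x : ℝ | ∃ j : ℕ, j ≤ k ∧ x = ((k - j : ℕ) : ℝ) / ((j : ℝ) + 1)}
  have hfin : J.Finite := by
    refine ((Set.finite_Iic k).image fun j : ℕ ↦ ((k - j : ℕ) : ℝ) / ((j : ℝ) + 1)).subset ?_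
    rintro x ⟨j, hj, rfl⟩
    exact ⟨j, hj, rfl⟩
  obtain ⟨ε, hε, hball⟩ := Metric.isOpen_iff.mp
    (hfin.isClosed.isOpen_compl.inter isOpen_Ioi) a ⟨hJ, ha⟩
  rw [Real.ball_eq_Ioo] at hball
  refine ⟨ε, hε, fun b b' _ _ hb hb' v w hv hw ↦ ?_⟩
  have hsum : v.1 + v.2 = w.1 + w.2 := hv.1.trans hw.1.symm
  rcases lt_trichotomy v.2 w.2 with hlt | heq | hlt
  · obtain ⟨j, hj, h₁, h₂⟩ := hv.exists_jump_between (hball hb').2 hw hlt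
    exact ((hball ⟨hb'.1.trans_le h₁, h₂.trans_lt hb.2⟩).1 ⟨j, hj, rfl⟩).elim
  · exact Prod.ext (by omega) heq
  · obtain ⟨j, hj, h₁, h₂⟩ := hw.exists_jump_between (hball hb).2 hv hlt
    exact ((hball ⟨hb.1.trans_le h₁, h₂.trans_lt hb'.2⟩).1 ⟨j, hj, rfl⟩).elim
end

section
/- Let α ≥ 1 and β ≥ 0 be integers, set k = α + β and a = α/(β+1). Then there exists ε > 0 such that Γ^{(1,b)}_k = (α−1, β+1) for every irrational b ∈ (a−ε, a) and Γ^{(1,b)}_k = (α, β) for every irrational b ∈ (a, a+ε). In particular, the one-sided limits satisfy Γ^{a⁻}_k = Γ^{a⁺}_k + (−1, 1). -/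
/-- A strict minimizer is a minimizer, and the only one. -/
lemma isMinPair_and_unique_of_lt {b : ℝ} {k : ℕ} {u : ℕ × ℕ} (hu : u.1 + u.2 = k)
    (h : ∀ w : ℕ × ℕ, w.1 + w.2 = k → w ≠ u →
      max (u.1 : ℝ) (b * u.2) < max (w.1 : ℝ) (b * w.2)) :
    IsMinPair b k u ∧ ∀ v : ℕ × ℕ, IsMinPair b k v → v = u := by
  refine ⟨⟨hu, fun w hw => ?_⟩, fun v hv => ?_⟩
  · by_cases hwu : w = u
    · rw [hwu]
    · exact (h w hw hwu).le
  · by_contra hvu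
    exact (h v hv.1 hvu).not_ge (hv.2 u hu)

/-- To the left of a pair on the same antidiagonal the second coordinate is larger, to its right
the first one is; so a pair is the unique minimizer as soon as its value of `max v₁ (b * v₂)` is
less than `b * (v₂ + 1)` and less than `v₁ + 1`. -/
lemma isMinPair_and_unique_of_max_lt {b : ℝ} (hb : 0 ≤ b) {k : ℕ} {u : ℕ × ℕ}
    (hu : u.1 + u.2 = k) (h₁ : max (u.1 : ℝ) (b * u.2) < u.1 + 1)
    (h₂ : max (u.1 : ℝ) (b * u.2) < b * (u.2 + 1)) :
    IsMinPair b k u ∧ ∀ v : ℕ × ℕ, IsMinPair b k v → v = u := by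
  refine isMinPair_and_unique_of_lt hu fun w hw hwu => ?_
  rcases lt_trichotomy w.1 u.1 with hlt | heq | hgt
  · have hw₂ : (u.2 : ℝ) + 1 ≤ w.2 := by
      have : u.2 + 1 ≤ w.2 := by omega
      exact_mod_cast this
    exact lt_max_of_lt_right (h₂.trans_le (mul_le_mul_of_nonneg_left hw₂ hb))
  · exact absurd (Prod.ext heq (by omega)) hwu
  · have hw₁ : (u.1 : ℝ) + 1 ≤ w.1 := by exact_mod_cast hgt
    exact lt_max_of_lt_left (h₁.trans_le hw₁)

/-- For integers `α ≥ 1`, `β ≥ 0`, `k = α + β` and `a = α/(β+1)`,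
for irrational `b` slightly below `a` the minimizer at level `k` is `(α-1, β+1)`,
and for irrational `b` slightly above `a` it is `(α, β)`; i.e.
`Γ^{a⁻}_k = Γ^{a⁺}_k + (-1, 1)`. -/
theorem stmt_10 (α β : ℕ) (hα : 1 ≤ α) :
    ∃ ε > 0,
      (∀ b : ℝ, Irrational b →
        b ∈ Set.Ioo ((α : ℝ) / ((β : ℝ) + 1) - ε) ((α : ℝ) / ((β : ℝ) + 1)) →
        (IsMinPair b (α + β) (α - 1, β + 1) ∧
          ∀ v : ℕ × ℕ, IsMinPair b (α + β) v → v = (α - 1, β + 1))) ∧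
      (∀ b : ℝ, Irrational b →
        b ∈ Set.Ioo ((α : ℝ) / ((β : ℝ) + 1)) ((α : ℝ) / ((β : ℝ) + 1) + ε) →
        (IsMinPair b (α + β) (α, β) ∧
          ∀ v : ℕ × ℕ, IsMinPair b (α + β) v → v = (α, β))) := by
  have hβ : (0 : ℝ) < (β : ℝ) + 1 := by positivity
  have hα' : (1 : ℝ) ≤ α := by exact_mod_cast hα
  have hβ₀ : (0 : ℝ) ≤ β := β.cast_nonneg
  refine ⟨1 / ((β : ℝ) + 1), by positivity, ?_, ?_⟩
  · rintro b - ⟨hlo, hhi⟩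
    rw [← sub_div, div_lt_iff₀ hβ] at hlo
    rw [lt_div_iff₀ hβ] at hhi
    have hb : 0 < b := pos_of_mul_pos_left (by linarith) hβ.le
    refine isMinPair_and_unique_of_max_lt hb.le (by dsimp only; omega) ?_ ?_ <;>
      push_cast [Nat.cast_sub hα] <;> refine max_lt ?_ ?_ <;> linarith
  · rintro b - ⟨hlo, hhi⟩
    rw [← add_div, lt_div_iff₀ hβ] at hhi
    rw [div_lt_iff₀ hβ] at hlo
    have hb : 0 < b := pos_of_mul_pos_left (by linarith) hβ.le
    refine isMinPair_and_unique_of_max_lt hb.le rfl ?_ ?_ <;>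
      dsimp only <;> refine max_lt ?_ ?_ <;> linarith
end

section
/- Let n ≥ 2, let a = (a₁,…,aₙ) be positive real numbers that are rationally independent, and fix indices 1 ≤ i < j ≤ n. Then for every k ∈ ℕ, the projection ((Γ^a_k)ᵢ, (Γ^a_k)ⱼ) ∈ (ℤ≥0)² equals Γ^{(aᵢ,aⱼ)}_m, where m = (Γ^a_k)ᵢ + (Γ^a_k)ⱼ. Consequently, the image of the projected path { ((Γ^a_k)ᵢ, (Γ^a_k)ⱼ) : k ∈ ℕ } in ℤ² equals the image { Γ^{(aᵢ,aⱼ)}_m : m ∈ ℕ } of the two-dimensional lattice path associated to (aᵢ, aⱼ). -/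
/-- If `v` minimizes the maximum of `a l * v l` among tuples with the same sum, and no two distinct
scaled coordinates can share a nonzero value, then `v` dominates every tuple whose scaled
coordinates are bounded by that maximum. -/
theorem le_of_minimizes_max {ι : Type*} [Fintype ι] [DecidableEq ι] {a : ι → ℝ}
    (hpos : ∀ l, 0 < a l)
    (hne : ∀ l l', l ≠ l' → ∀ x y : ℕ, a l * x = a l' * y → y = 0)
    {v : ι → ℕ}
    (hv : ∀ w : ι → ℕ, ∑ l, w l = ∑ l, v l → ∀ p, ∃ l, a p * (v p : ℝ) ≤ a l * (w l : ℝ))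
    {p : ι} (hp : ∀ l, a l * (v l : ℝ) ≤ a p * (v p : ℝ))
    {w : ι → ℕ} (hw : ∀ l, a l * (w l : ℝ) ≤ a p * (v p : ℝ)) (l : ι) : w l ≤ v l := by
  by_contra! hlt
  have hlp : l ≠ p := by
    rintro rfl
    have h := le_of_mul_le_mul_left (hw l) (hpos l)
    exact absurd (Nat.cast_le.mp h) (not_le.mpr hlt)
  have hstep : a l * ((v l + 1 : ℕ) : ℝ) ≤ a p * (v p : ℝ) :=
    (mul_le_mul_of_nonneg_left (Nat.cast_le.mpr hlt) (hpos l).le).trans (hw l)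
  have hvp : v p ≠ 0 := by
    intro h0
    have h : 0 < a l * ((v l + 1 : ℕ) : ℝ) := mul_pos (hpos l) (by positivity)
    simp only [h0, Nat.cast_zero, mul_zero] at hstep
    linarith
  obtain ⟨q, hq⟩ := hv (Function.update (Function.update v p (v p - 1)) l (v l + 1)) (by
    rw [Finset.sum_update_of_mem (Finset.mem_univ l),
      Finset.sum_update_of_mem (by simpa using hlp.symm),
      ← Finset.add_sum_erase Finset.univ v (Finset.mem_univ l), Finset.sdiff_singleton_eq_erase,
      ← Finset.add_sum_erase (Finset.univ.erase l) v (by simpa using hlp.symm),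
      Finset.sdiff_singleton_eq_erase]
    omega) p
  rcases eq_or_ne q l with rfl | hql
  · rw [Function.update_self] at hq
    exact hvp (hne q p hlp _ _ (le_antisymm hstep hq))
  rw [Function.update_of_ne hql] at hq
  rcases eq_or_ne q p with rfl | hqp
  · rw [Function.update_self] at hq
    have h := Nat.cast_le.mp (le_of_mul_le_mul_left hq (hpos q))
    omega
  · rw [Function.update_of_ne hqp] at hq
    exact hvp (hne q p hqp _ _ (le_antisymm (hp q) hq))

/-- Natural multiples of distinct rationally independent reals agree only at zero. -/
theorem LinearIndependent.eq_zero_of_mul_natCast_eq_s15 {ι : Type*} {a : ι → ℝ}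
    (hind : LinearIndependent ℚ a) {l l' : ι} (hl : l ≠ l') {x y : ℕ}
    (h : a l * (x : ℝ) = a l' * (y : ℝ)) : y = 0 := by
  have hpair := hind.comp ![l, l'] (by
    intro s t hst
    fin_cases s <;> fin_cases t <;> simp_all [eq_comm])
  have h0 := Fintype.linearIndependent_iff.mp hpair ![(x : ℚ), -(y : ℚ)] (by
    simp only [Fin.sum_univ_two, Function.comp_apply, Matrix.cons_val_zero, Matrix.cons_val_one,
      Rat.smul_def]
    push_cast
    linarith) 1
  simpa using h0


/-- Projecting the `n`-dimensional lattice path `Γ` of a rationally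
independent tuple `a` to coordinates `i < j` yields the two-dimensional lattice
path `Γ₂` of `(a i, a j)`: the projection of `Γ k` equals `Γ₂ m` with
`m = Γ k i + Γ k j`, and the images of the two paths coincide. -/
theorem stmt_15 (n : ℕ) (hn : 2 ≤ n) (a : Fin n → ℝ) (hpos : ∀ i, 0 < a i)
    (hind : LinearIndependent ℚ a) (i j : Fin n) (hij : i < j)
    (Γ : ℕ → Fin n → ℕ) (hsum : ∀ k, ∑ l, Γ k l = k)
    (hmin : ∀ k, ∀ w : Fin n → ℕ, ∑ l, w l = k →
      (⨆ l, a l * (Γ k l : ℝ)) ≤ ⨆ l, a l * (w l : ℝ))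
    (Γ₂ : ℕ → ℕ × ℕ) (h2sum : ∀ m, (Γ₂ m).1 + (Γ₂ m).2 = m)
    (h2min : ∀ m, ∀ w : ℕ × ℕ, w.1 + w.2 = m →
      max (a i * ((Γ₂ m).1 : ℝ)) (a j * ((Γ₂ m).2 : ℝ)) ≤
        max (a i * (w.1 : ℝ)) (a j * (w.2 : ℝ))) :
    (∀ k, Γ₂ (Γ k i + Γ k j) = (Γ k i, Γ k j)) ∧
    Set.range (fun k => ((Γ k i, Γ k j) : ℕ × ℕ)) = Set.range Γ₂ := by
  have hne : ∀ l l', l ≠ l' → ∀ x y : ℕ, a l * x = a l' * y → y = 0 :=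
    fun l l' hl x y h => hind.eq_zero_of_mul_natCast_eq_s15 hl h
  have hnon : Nonempty (Fin n) := ⟨i⟩
  have hΓ : ∀ k, ∀ w : Fin n → ℕ, ∑ l, w l = k →
      ∀ p, ∃ l, a p * (Γ k p : ℝ) ≤ a l * (w l : ℝ) := by
    intro k w hw p
    obtain ⟨l, hl⟩ := exists_eq_ciSup_of_finite (f := fun l => a l * (w l : ℝ))
    refine ⟨l, ?_⟩
    have h1 := le_ciSup (f := fun l => a l * (Γ k l : ℝ)) (Set.finite_range _).bddAbove p
    exact h1.trans ((hmin k w hw).trans hl.ge)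
  have hproj : ∀ k, Γ₂ (Γ k i + Γ k j) = (Γ k i, Γ k j) := by
    intro k
    obtain ⟨p, hp⟩ := Finite.exists_max (fun l => a l * (Γ k l : ℝ))
    set u := Γ₂ (Γ k i + Γ k j) with hu
    have hsu := h2sum (Γ k i + Γ k j)
    have hmax := (h2min _ (Γ k i, Γ k j) rfl).trans (max_le (hp i) (hp j))
    rw [← hu] at hsu hmax
    obtain ⟨hui, huj⟩ := max_le_iff.mp hmax
    have hle := le_of_minimizes_max hpos hne (by simpa [hsum] using hΓ k) hp
      (w := Function.update (Function.update 0 i u.1) j u.2) (by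
        intro l
        rcases eq_or_ne l j with rfl | hlj
        · simpa using huj
        rw [Function.update_of_ne hlj]
        rcases eq_or_ne l i with rfl | hli
        · simpa using hui
        rw [Function.update_of_ne hli]
        have := hpos p
        simp only [Pi.zero_apply, Nat.cast_zero, mul_zero]
        positivity)
    have hi := hle i
    have hj := hle j
    rw [Function.update_of_ne hij.ne, Function.update_self] at hi
    rw [Function.update_self] at hj
    exact Prod.ext (by simp only; omega) (by simp only; omega)
  refine ⟨hproj, Set.Subset.antisymm ?_ ?_⟩
  · rintro _ ⟨k, rfl⟩
    exact ⟨_, hproj k⟩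
  rintro _ ⟨m, rfl⟩
  set u := Γ₂ m with hu
  set M := max (a i * (u.1 : ℝ)) (a j * (u.2 : ℝ)) with hM
  have hM0 : 0 ≤ M := le_max_of_le_left (mul_nonneg (hpos i).le (Nat.cast_nonneg _))
  set f : Fin n → ℕ := fun l => ⌊M / a l⌋₊ with hf
  have hfM : ∀ l, a l * (f l : ℝ) ≤ M := fun l => by
    rw [mul_comm, ← le_div_iff₀ (hpos l)]
    exact Nat.floor_le (div_nonneg hM0 (hpos l).le)
  have le_f : ∀ l (x : ℕ), a l * (x : ℝ) ≤ M → x ≤ f l := fun l x hx => by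
    apply Nat.le_floor
    rw [le_div_iff₀ (hpos l), mul_comm]
    exact hx
  have hΓf : ∀ l, Γ (∑ l, f l) l = f l := by
    have hle : ∀ l ∈ Finset.univ, Γ (∑ l, f l) l ≤ f l := fun l _ => by
      obtain ⟨q, hq⟩ := hΓ _ f rfl l
      exact le_f l _ (hq.trans (hfM q))
    exact fun l => (Finset.sum_eq_sum_iff_of_le hle).mp (hsum _) l (Finset.mem_univ l)
  obtain ⟨p, hp⟩ := Finite.exists_max (fun l : Fin 2 => ![a i, a j] l * ((![u.1, u.2] l : ℕ) : ℝ))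
  have hpM : M ≤ ![a i, a j] p * ((![u.1, u.2] p : ℕ) : ℝ) := max_le (hp 0) (hp 1)
  have hle := le_of_minimizes_max (a := ![a i, a j]) (v := ![u.1, u.2]) (p := p)
    (w := ![f i, f j])
    (by simp [Fin.forall_fin_two, hpos])
    (by
      simp only [Fin.forall_fin_two, Matrix.cons_val_zero, Matrix.cons_val_one]
      exact ⟨⟨fun h => absurd rfl h, fun _ => hne i j hij.ne⟩,
        ⟨fun _ => hne j i hij.ne', fun h => absurd rfl h⟩⟩)
    (by
      intro w hw q
      simp only [Fin.sum_univ_two, Matrix.cons_val_zero, Matrix.cons_val_one] at hw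
      have h := h2min m (w 0, w 1) (hw.trans (h2sum m))
      have hqM : ![a i, a j] q * ((![u.1, u.2] q : ℕ) : ℝ) ≤ M := by
        fin_cases q
        · exact le_max_left _ _
        · exact le_max_right _ _
      rcases le_max_iff.mp (hqM.trans h) with h | h
      · exact ⟨0, h⟩
      · exact ⟨1, h⟩)
    hp
    (by
      rw [Fin.forall_fin_two]
      exact ⟨(hfM i).trans hpM, (hfM j).trans hpM⟩)
  refine ⟨∑ l, f l, Prod.ext ?_ ?_⟩
  · exact (hΓf i).trans (le_antisymm (hle 0) (le_f i _ (le_max_left _ _)))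
  · exact (hΓf j).trans (le_antisymm (hle 1) (le_f j _ (le_max_right _ _)))
end

section
/- Let Fib be the Fibonacci sequence with Fib 1 = Fib 2 = 1 and Fib(m+2) = Fib(m) + Fib(m+1), and for each integer i ≥ 1 set pᵢ = Fib(2i+3) and qᵢ = Fib(2i−1). Let 𝒮 = { (pᵢ + k)/(qᵢ − k) : i ∈ ℤ≥1, k ∈ ℤ, 0 ≤ k ≤ qᵢ − 1 } ⊆ ℝ, and let τ = (1+√5)/2 be the golden ratio, so that τ⁴ = (7 + 3√5)/2. Then the interval [τ⁴, ∞) is contained in the closure of 𝒮; that is, 𝒮 is dense in [τ⁴, ∞). -/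
open Filter Topology

/-- The ratio `fib (n + 4) / fib n` lies below the fourth power of the golden ratio for odd `n`. -/
theorem Nat.fib_add_four_lt_mul_fib {n : ℕ} (hn : Odd n) :
    (Nat.fib (n + 4) : ℝ) < (7 + 3 * Real.sqrt 5) / 2 * Nat.fib n := by
  have hsub := Real.fib_succ_sub_goldenRatio_mul_fib n
  have hneg : Real.goldenConj ^ n < 0 := hn.pow_neg Real.goldenConj_neg
  have hfib : Nat.fib (n + 4) = 3 * Nat.fib (n + 1) + 2 * Nat.fib n := by
    have h₂ := Nat.fib_add_two (n := n)
    have h₃ := Nat.fib_add_two (n := n + 1)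
    have h₄ := Nat.fib_add_two (n := n + 2)
    simp only [add_assoc, Nat.reduceAdd] at h₂ h₃ h₄
    lia
  rw [hfib]
  push_cast
  rw [Real.goldenRatio] at hsub
  linarith

/-- With `pᵢ = Fib(2i+3)`, `qᵢ = Fib(2i-1)` (odd-index Fibonacci
ratios), the set `𝒮 = { (pᵢ + k)/(qᵢ - k) : i ≥ 1, 0 ≤ k ≤ qᵢ - 1 }` is dense in
`[τ⁴, ∞)`, where `τ⁴ = (7 + 3√5)/2` is the fourth power of the golden ratio. -/
theorem stmt_17 :
    Set.Ici ((7 + 3 * Real.sqrt 5) / 2) ⊆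
      closure {x : ℝ | ∃ i : ℕ, 1 ≤ i ∧ ∃ k : ℕ, k < Nat.fib (2 * i - 1) ∧
        x = ((Nat.fib (2 * i + 3) + k : ℕ) : ℝ) / ((Nat.fib (2 * i - 1) - k : ℕ) : ℝ)} := by
  intro x hx
  rw [Set.mem_Ici] at hx
  have hx₁ : 0 < x + 1 := by linarith [Real.sqrt_nonneg 5]
  let s : ℕ → ℝ := fun i => (Nat.fib (2 * i + 3) : ℝ) + Nat.fib (2 * i - 1)
  have hs_ge (i : ℕ) : (i : ℝ) ≤ s i := by
    have h : i ≤ Nat.fib (2 * i + 3) := by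
      have := Nat.le_fib_add_one (2 * i + 3)
      lia
    have h' : (i : ℝ) ≤ Nat.fib (2 * i + 3) := by exact_mod_cast h
    exact h'.trans (le_add_of_nonneg_right (Nat.cast_nonneg _))
  have hs : Tendsto s atTop atTop := tendsto_atTop_mono hs_ge tendsto_natCast_atTop_atTop
  have hlim : Tendsto (fun i => (⌈(x + 1)⁻¹ * s i⌉₊ / s i : ℝ)⁻¹ - 1) atTop (𝓝 x) := by
    simpa using (((tendsto_nat_ceil_mul_div_atTop (inv_nonneg.2 hx₁.le)).comp hs).inv₀
      (inv_ne_zero hx₁.ne')).sub_const 1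
  refine mem_closure_of_tendsto hlim ?_
  filter_upwards [eventually_ge_atTop 1] with i hi
  have hs_pos : 0 < s i := (Nat.cast_pos.2 hi).trans_le (hs_ge i)
  set m := ⌈(x + 1)⁻¹ * s i⌉₊ with hm
  have hm_pos : 0 < m := Nat.ceil_pos.2 (by positivity)
  have hm_le : m ≤ Nat.fib (2 * i - 1) := by
    have hlt := Nat.fib_add_four_lt_mul_fib (n := 2 * i - 1) ⟨i - 1, by lia⟩
    rw [show 2 * i - 1 + 4 = 2 * i + 3 by lia] at hlt
    rw [hm, Nat.ceil_le, inv_mul_le_iff₀ hx₁]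
    have := mul_le_mul_of_nonneg_right hx (Nat.cast_nonneg (α := ℝ) (Nat.fib (2 * i - 1)))
    simp only [s]
    linarith
  refine ⟨i, hi, Nat.fib (2 * i - 1) - m, by lia, ?_⟩
  rw [Nat.sub_sub_self hm_le]
  push_cast [Nat.cast_sub hm_le]
  have : (m : ℝ) ≠ 0 := by positivity
  simp only [s]
  rw [inv_div]
  field_simp
  ring
end
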